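/- Let H = ℓ²(ℤ, ℂ) with canonical orthonormal basis (e_n)_{n∈ℤ}, let U be the bilateral shift on H, and for each s : ℤ → ℂ vanishing at ±∞ (i.e. s(n) → 0 as n → +∞ and as n → −∞) let Diag(s) be the bounded operator with Diag(s)(e_n) = s(n)·e_n. Then the closure, in the operator norm of B(H), of the star-subalgebra of B(H) generated by the set {Uⁿ ∘ Diag(s) : n ∈ ℤ, s vanishing at ±∞} equals the set of compact operators on H. -/

import Mathlib

/-- The Hilbert space `ℓ²(ℤ, ℂ)`. -/
noncomputable abbrev l2Z : Type := lp (fun _ : ℤ => ℂ) 2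

open InnerProductSpace Filter Topology

section HilbertBasis

variable {ι 𝕜 E : Type*} [RCLike 𝕜] [NormedAddCommGroup E] [InnerProductSpace 𝕜 E]

/-- Bessel's inequality for the partial sums of an orthonormal expansion. -/
lemma Orthonormal.norm_sum_inner_smul_le {v : ι → E} (hv : Orthonormal 𝕜 v) (s : Finset ι)
    (x : E) : ‖∑ i ∈ s, inner 𝕜 (v i) x • v i‖ ≤ ‖x‖ := by
  refine (sq_le_sq₀ (norm_nonneg _) (norm_nonneg x)).1
    (le_trans (le_of_eq ?_) (hv.sum_inner_products_le (s := s) x))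
  rw [← RCLike.ofReal_inj (K := 𝕜), RCLike.ofReal_pow, ← inner_self_eq_norm_sq_to_K, hv.inner_sum]
  simp only [RCLike.conj_mul, map_sum, map_pow]

lemma HilbertBasis.hasSum_inner_smul (b : HilbertBasis ι 𝕜 E) (x : E) :
    HasSum (fun i => inner 𝕜 (b i) x • b i) x := by
  simpa [b.repr_apply_apply] using b.hasSum_repr x

lemma InnerProductSpace.isCompactOperator_rankOne (x y : E) :
    IsCompactOperator (rankOne 𝕜 x y) := by
  rw [rankOne_def']
  have h : IsCompactOperator (ContinuousLinearMap.toSpanSingleton 𝕜 x) :=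
    isCompactOperator_of_locallyCompactSpace_rng _
  exact h.comp_clm (innerSL 𝕜 y)

variable [CompleteSpace E]

/-- A compact operator is the norm limit of its finite-rank compressions to the spans of finitely
many vectors of a Hilbert basis. -/
theorem IsCompactOperator.hasSum_rankOne {T : E →L[𝕜] E} (hT : IsCompactOperator T)
    (b : HilbertBasis ι 𝕜 E) :
    HasSum (fun i => rankOne 𝕜 (b i) (ContinuousLinearMap.adjoint T (b i))) T := by
  have happ (s : Finset ι) (x : E) :
      (∑ i ∈ s, rankOne 𝕜 (b i) (ContinuousLinearMap.adjoint T (b i))) x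
        = ∑ i ∈ s, inner 𝕜 (b i) (T x) • b i := by
    simp [ContinuousLinearMap.adjoint_inner_left]
  rw [HasSum, Metric.tendsto_nhds]
  intro ε hε
  obtain ⟨K, hK, hTK⟩ := IsCompactOperator.image_closedBall_subset_compact
    (f := (T : E →ₗ[𝕜] E)) hT 1
  obtain ⟨t, -, ht, hKt⟩ := hK.finite_cover_balls (show 0 < ε / 4 by positivity)
  have hev : ∀ᶠ s : Finset ι in atTop, ∀ y ∈ t,
      dist (∑ i ∈ s, inner 𝕜 (b i) y • b i) y < ε / 4 :=
    (eventually_all_finite ht).2 fun y _ =>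
      Metric.tendsto_nhds.1 (b.hasSum_inner_smul y) _ (by positivity)
  filter_upwards [hev] with s hs
  rw [dist_eq_norm]
  refine lt_of_le_of_lt (ContinuousLinearMap.opNorm_le_of_unit_norm
    (C := 3 * (ε / 4)) (by positivity) fun x hx => ?_) (by linarith)
  obtain ⟨y, hy, hxy⟩ := Set.mem_iUnion₂.1
    (hKt (hTK ⟨x, by simp [hx], rfl⟩ : T x ∈ K))
  have hys := hs y hy
  rw [dist_eq_norm] at hys
  have hxy' : ‖T x - y‖ < ε / 4 := by rwa [Metric.mem_ball, dist_eq_norm] at hxy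
  rw [sub_apply, happ]
  have hsplit : ∑ i ∈ s, inner 𝕜 (b i) (T x) • b i - T x
      = ∑ i ∈ s, inner 𝕜 (b i) (T x - y) • b i
        + (∑ i ∈ s, inner 𝕜 (b i) y • b i - y) - (T x - y) := by
    simp only [inner_sub_right, sub_smul, Finset.sum_sub_distrib]
    abel
  rw [hsplit]
  have hB := b.orthonormal.norm_sum_inner_smul_le s (T x - y)
  have h1 := norm_sub_le (∑ i ∈ s, inner 𝕜 (b i) (T x - y) • b i
        + (∑ i ∈ s, inner 𝕜 (b i) y • b i - y)) (T x - y)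
  have h2 := norm_add_le (∑ i ∈ s, inner 𝕜 (b i) (T x - y) • b i)
    (∑ i ∈ s, inner 𝕜 (b i) y • b i - y)
  linarith

/-- Schauder's theorem for operators on a Hilbert space. -/
theorem IsCompactOperator.adjoint {T : E →L[𝕜] E} (hT : IsCompactOperator T) :
    IsCompactOperator (ContinuousLinearMap.adjoint T) := by
  obtain ⟨w, b, -⟩ := exists_hilbertBasis 𝕜 E
  have h := ((ContinuousLinearMap.adjoint (𝕜 := 𝕜) (E := E) (F := E)).continuous.tendsto T).comp
    (hT.hasSum_rankOne b)
  refine isCompactOperator_of_tendsto h (Eventually.of_forall fun s => ?_)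
  simp only [Function.comp_apply, map_sum, adjoint_rankOne]
  exact (compactOperator (RingHom.id 𝕜) E E).sum_mem fun i _ => isCompactOperator_rankOne _ _

/-- A closed subspace of operators containing all matrix units of a Hilbert basis contains every
compact operator. -/
theorem IsCompactOperator.mem_of_rankOne_mem {T : E →L[𝕜] E} (hT : IsCompactOperator T)
    (b : HilbertBasis ι 𝕜 E) {S : Submodule 𝕜 (E →L[𝕜] E)} (hS : IsClosed (S : Set (E →L[𝕜] E)))
    (h : ∀ i j, rankOne 𝕜 (b i) (b j) ∈ S) : T ∈ S := by
  have hrow (i : ι) (y : E) : rankOne 𝕜 (b i) y ∈ S := by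
    refine hS.mem_of_tendsto
      ((rankOne 𝕜 (b i)).continuous.continuousAt.tendsto.comp (b.hasSum_inner_smul y))
      (Eventually.of_forall fun s => ?_)
    simp only [Function.comp_apply, map_sum, map_smulₛₗ]
    exact S.sum_mem fun j _ => S.smul_mem _ (h i j)
  exact hS.mem_of_tendsto (hT.hasSum_rankOne b)
    (Eventually.of_forall fun s => S.sum_mem fun i _ => hrow _ _)

end HilbertBasis

/-- The canonical Hilbert basis of `ℓ²(ℤ, ℂ)`. -/
noncomputable def l2Z.basis : HilbertBasis ℤ ℂ l2Z :=
  HilbertBasis.ofRepr (LinearIsometryEquiv.refl ℂ l2Z)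

lemma l2Z.basis_apply (i m : ℤ) : l2Z.basis i m = if m = i then 1 else 0 := by
  have h : l2Z.basis i = lp.single 2 i (1 : ℂ) := by
    rw [← l2Z.basis.repr_symm_single]; rfl
  rw [h, lp.single_apply, Pi.single_apply]

lemma l2Z.inner_basis (i : ℤ) (x : l2Z) : inner ℂ (l2Z.basis i) x = x i :=
  (l2Z.basis.repr_apply_apply x i).symm

lemma l2Z.isCompactOperator_diag {T : l2Z →L[ℂ] l2Z} {s : ℤ → ℂ} (hs : Tendsto s cofinite (𝓝 0))
    (hT : ∀ (x : l2Z) (m : ℤ), (T x) m = s m * x m) : IsCompactOperator T := by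
  have hcoord (F : Finset ℤ) (x : l2Z) (m : ℤ) :
      ((∑ i ∈ F, s i • rankOne ℂ (l2Z.basis i) (l2Z.basis i)) x) m
        = if m ∈ F then s m * x m else 0 := by
    rw [sum_apply, lp.coeFn_sum, Finset.sum_apply]
    simp [l2Z.inner_basis, l2Z.basis_apply]
  refine isCompactOperator_of_tendsto (l := atTop)
    (F := fun F : Finset ℤ => ∑ i ∈ F, s i • rankOne ℂ (l2Z.basis i) (l2Z.basis i)) ?_
    (Eventually.of_forall fun F => (compactOperator (RingHom.id ℂ) l2Z l2Z).sum_mem fun i _ =>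
      (compactOperator (RingHom.id ℂ) l2Z l2Z).smul_mem _ (isCompactOperator_rankOne _ _))
  rw [Metric.tendsto_nhds]
  intro ε hε
  have hfin : {m | ¬ dist (s m) 0 < ε / 2}.Finite :=
    Metric.tendsto_nhds.1 hs (ε / 2) (by positivity)
  filter_upwards [eventually_ge_atTop hfin.toFinset] with F hF
  rw [dist_eq_norm]
  refine lt_of_le_of_lt (ContinuousLinearMap.opNorm_le_bound _ (M := ε / 2) (by positivity)
    fun x => ?_) (by linarith)
  have hnorm : ‖((ε / 2 : ℝ) : ℂ) • x‖ = ε / 2 * ‖x‖ := by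
    rw [norm_smul, Complex.norm_real, Real.norm_of_nonneg (by positivity)]
  rw [← hnorm]
  refine lp.norm_mono two_ne_zero fun m => ?_
  rw [sub_apply, lp.coeFn_sub, Pi.sub_apply, hcoord, hT, lp.coeFn_smul, Pi.smul_apply, norm_smul,
    Complex.norm_real, Real.norm_of_nonneg (by positivity : 0 ≤ ε / 2)]
  split_ifs with hm
  · simpa using by positivity
  · have : ‖s m‖ < ε / 2 := by
      by_contra hlt
      exact hm (hF (by simpa using hlt))
    rw [zero_sub, norm_neg, norm_mul]
    gcongr

/-- Let `W n` (`n ∈ ℤ`) be the `n`-th power of the bilateral shift on `ℓ²(ℤ,ℂ)`, i.e.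
`(W n ξ)ₘ = ξ_{m−n}`, and let `D s` be the diagonal operator `(D s ξ)ₘ = s(m)·ξₘ` for every
`s : ℤ → ℂ` vanishing at `±∞`.  Then the operator-norm closure of the star-subalgebra of
`B(ℓ²(ℤ,ℂ))` generated by `{Uⁿ ∘ Diag(s) : n ∈ ℤ, s vanishing at ±∞}` is exactly the set
of compact operators. -/
theorem stmt15 (W : ℤ → (l2Z →L[ℂ] l2Z))
    (hW : ∀ (n : ℤ) (ξ : l2Z) (m : ℤ), (W n ξ) m = ξ (m - n))
    (D : (ℤ → ℂ) → (l2Z →L[ℂ] l2Z))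
    (hD : ∀ s : ℤ → ℂ,
      Filter.Tendsto s Filter.atTop (nhds 0) → Filter.Tendsto s Filter.atBot (nhds 0) →
      ∀ (ξ : l2Z) (m : ℤ), (D s ξ) m = s m * ξ m) :
    closure ((NonUnitalStarAlgebra.adjoin ℂ
        {T : l2Z →L[ℂ] l2Z | ∃ n : ℤ, ∃ s : ℤ → ℂ,
          Filter.Tendsto s Filter.atTop (nhds 0) ∧ Filter.Tendsto s Filter.atBot (nhds 0) ∧
          T = (W n).comp (D s)} : Set (l2Z →L[ℂ] l2Z)))
      = {T : l2Z →L[ℂ] l2Z | IsCompactOperator T} := by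
  set A := NonUnitalStarAlgebra.adjoin ℂ
        {T : l2Z →L[ℂ] l2Z | ∃ n : ℤ, ∃ s : ℤ → ℂ,
          Filter.Tendsto s Filter.atTop (nhds 0) ∧ Filter.Tendsto s Filter.atBot (nhds 0) ∧
          T = (W n).comp (D s)} with hA
  apply Set.Subset.antisymm
  · refine closure_minimal (fun T hT => ?_) isClosed_setOfPred_isCompactOperator
    induction hT using NonUnitalStarAlgebra.adjoin_induction with
    | mem T hT =>
      obtain ⟨n, s, htop, hbot, rfl⟩ := hT
      exact (l2Z.isCompactOperator_diag (by rw [Int.cofinite_eq]; exact hbot.sup htop)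
        (hD s htop hbot)).clm_comp (W n)
    | add S T _ _ hS hT => exact hS.add hT
    | zero => exact isCompactOperator_zero
    | mul S T _ _ hS hT => exact hS.comp_clm T
    | smul c T _ hT => exact hT.smul c
    | star T _ hT => exact hT.adjoint
  · intro T hT
    refine IsCompactOperator.mem_of_rankOne_mem (S := A.toSubmodule.topologicalClosure) hT
      l2Z.basis isClosed_closure fun i j => subset_closure ?_
    have h0 : Tendsto (Pi.single j 1 : ℤ → ℂ) cofinite (𝓝 0) :=
      tendsto_nhds_of_eventually_eq <| (Set.finite_singleton j).subset fun m hm => by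
        by_contra hne
        exact hm (Pi.single_eq_of_ne hne 1)
    rw [Int.cofinite_eq, tendsto_sup] at h0
    refine NonUnitalStarAlgebra.subset_adjoin ℂ _ ⟨i - j, Pi.single j 1, h0.2, h0.1, ?_⟩
    ext x m
    rw [rankOne_apply, lp.coeFn_smul, Pi.smul_apply, l2Z.inner_basis, l2Z.basis_apply,
      ContinuousLinearMap.comp_apply, hW, hD _ h0.2 h0.1, Pi.single_apply]
    by_cases hm : m = i
    · subst hm; simp
    · rw [if_neg hm, if_neg (by omega)]; simp
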